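/- For i = 1,2, the function z ↦ (f_i·z) e^{a(c_i)·z} − 𝔼_z[f_i·S(τ) e^{a(c_i)·S(τ)}; τ < ∞] is well-defined and nonnegative on K. -/

import Mathlib

open scoped ENNReal Classical

noncomputable section

namespace KilledRW

/-- The two-dimensional integer lattice. -/
abbrev Z2 := ℤ × ℤ

/-- The plane `ℝ²`. -/
abbrev R2 := ℝ × ℝ

/-- Euclidean dot product on `ℝ²`. -/
def dotR (a b : R2) : ℝ := a.1 * b.1 + a.2 * b.2

/-- Embedding of the lattice into the plane. -/
def emb (z : Z2) : R2 := ((z.1 : ℝ), (z.2 : ℝ))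

/-- Euclidean norm on `ℝ²`. -/
def nrm (x : R2) : ℝ := Real.sqrt (dotR x x)

/-- The jump generating function `φ(a) = Σ_z γ(z) e^{a·z}`. -/
def jgf (γ : Z2 → ℝ) (a : R2) : ℝ := ∑' z : Z2, γ z * Real.exp (dotR a (emb z))

/-- The gradient `∇φ(a) = Σ_z z γ(z) e^{a·z}` of the jump generating function. -/
def gradJgf (γ : Z2 → ℝ) (a : R2) : R2 :=
  (∑' z : Z2, γ z * Real.exp (dotR a (emb z)) * (z.1 : ℝ),
   ∑' z : Z2, γ z * Real.exp (dotR a (emb z)) * (z.2 : ℝ))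

/-- The normalized gradient `q(a) = ∇φ(a)/|∇φ(a)|`. -/
def qmap (γ : Z2 → ℝ) (a : R2) : R2 := (nrm (gradJgf γ a))⁻¹ • gradJgf γ a

/-- (Sub)stochastic transition kernel of the twisted random walk `S_a`:
`p_a(z,z') = γ(z'-z) e^{a·(z'-z)}`.  For `a = 0` this is the kernel of the original walk. -/
def twKer (γ : Z2 → ℝ) (a : R2) (z z' : Z2) : ℝ≥0∞ :=
  ENNReal.ofReal (γ (z' - z) * Real.exp (dotR a (emb (z' - z))))

/-- `n`-step transition probabilities of the (sub)stochastic kernel `κ`. -/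
def nstep (κ : Z2 → Z2 → ℝ≥0∞) : ℕ → Z2 → Z2 → ℝ≥0∞
  | 0, z, z' => if z' = z then 1 else 0
  | n + 1, z, z' => ∑' w : Z2, κ z w * nstep κ n w z'

/-- `exitP κ A n z z' = ℙ_z(τ_A = n, S(n) = z')`: the probability that the walk with kernel `κ`
started at `z` stays in `A` strictly before time `n` and is at `z' ∉ A` at time `n`
(where `τ_A = inf{n ≥ 0 : S(n) ∉ A}`). -/
def exitP (κ : Z2 → Z2 → ℝ≥0∞) (A : Set Z2) : ℕ → Z2 → Z2 → ℝ≥0∞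
  | 0, z, z' => if z' = z ∧ z ∉ A then 1 else 0
  | n + 1, z, z' => if z ∈ A then ∑' w : Z2, κ z w * exitP κ A n w z' else 0

/-- `aliveP κ A n z z' = ℙ_z(τ_A > n, S(n) = z')`. -/
def aliveP (κ : Z2 → Z2 → ℝ≥0∞) (A : Set Z2) : ℕ → Z2 → Z2 → ℝ≥0∞
  | 0, z, z' => if z' = z ∧ z ∈ A then 1 else 0
  | n + 1, z, z' => if z ∈ A then ∑' w : Z2, κ z w * aliveP κ A n w z' else 0

/-- `ℙ_z(τ_A < ∞)` for the walk with kernel `κ`. -/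
def exitTotal (κ : Z2 → Z2 → ℝ≥0∞) (A : Set Z2) (z : Z2) : ℝ≥0∞ :=
  ∑' n : ℕ, ∑' z' : Z2, exitP κ A n z z'

/-- `𝔼_z[g(S(τ_A)); τ_A < ∞]` for a nonnegative integrand, with values in `ℝ≥0∞`. -/
def exitLExp (κ : Z2 → Z2 → ℝ≥0∞) (A : Set Z2) (z : Z2) (g : Z2 → ℝ) : ℝ≥0∞ :=
  ∑' n : ℕ, ∑' z' : Z2, exitP κ A n z z' * ENNReal.ofReal (g z')

/-- `𝔼_z[g(S(τ_A)); τ_A < ∞]` for a signed integrand (positive part minus negative part). -/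
def exitExp (κ : Z2 → Z2 → ℝ≥0∞) (A : Set Z2) (z : Z2) (g : Z2 → ℝ) : ℝ :=
  (exitLExp κ A z g).toReal - (exitLExp κ A z fun w => -g w).toReal

/-- `𝔼_z[g(S(τ_A)); τ_A ≤ n]`, nonnegative version. -/
def exitLExpTrunc (κ : Z2 → Z2 → ℝ≥0∞) (A : Set Z2) (z : Z2) (g : Z2 → ℝ) (n : ℕ) : ℝ≥0∞ :=
  ∑ m ∈ Finset.range (n + 1), ∑' z' : Z2, exitP κ A m z z' * ENNReal.ofReal (g z')

/-- `𝔼_z[g(S(τ_A)); τ_A ≤ n]`, signed version. -/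
def exitExpTrunc (κ : Z2 → Z2 → ℝ≥0∞) (A : Set Z2) (z : Z2) (g : Z2 → ℝ) (n : ℕ) : ℝ :=
  (exitLExpTrunc κ A z g n).toReal - (exitLExpTrunc κ A z (fun w => -g w) n).toReal

/-- `𝔼_z[g(S(n)); τ_A > n]`, nonnegative version. -/
def aliveLExpAt (κ : Z2 → Z2 → ℝ≥0∞) (A : Set Z2) (z : Z2) (g : Z2 → ℝ) (n : ℕ) : ℝ≥0∞ :=
  ∑' z' : Z2, aliveP κ A n z z' * ENNReal.ofReal (g z')

/-- `𝔼_z[g(S(n)); τ_A > n]`, signed version. -/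
def aliveExpAt (κ : Z2 → Z2 → ℝ≥0∞) (A : Set Z2) (z : Z2) (g : Z2 → ℝ) (n : ℕ) : ℝ :=
  (aliveLExpAt κ A z g n).toReal - (aliveLExpAt κ A z (fun w => -g w) n).toReal

lemma tsum_exitP_zero_mul (κ : Z2 → Z2 → ℝ≥0∞) (A : Set Z2) (G : Z2 → ℝ≥0∞) (z : Z2) :
    ∑' z', exitP κ A 0 z z' * G z' = if z ∈ A then 0 else G z := by
  rw [tsum_eq_single z (fun z' h => by simp [exitP, h])]
  by_cases h : z ∈ A <;> simp [exitP, h]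

lemma tsum_exitP_succ_mul (κ : Z2 → Z2 → ℝ≥0∞) (A : Set Z2) (G : Z2 → ℝ≥0∞) (n : ℕ) (z : Z2) :
    ∑' z', exitP κ A (n + 1) z z' * G z' =
      if z ∈ A then ∑' w, κ z w * ∑' z', exitP κ A n w z' * G z' else 0 := by
  by_cases h : z ∈ A
  · simp only [exitP, h, if_true, ← ENNReal.tsum_mul_right, ← ENNReal.tsum_mul_left]
    rw [ENNReal.tsum_comm]
    simp only [mul_assoc]
  · simp [exitP, h]

/-- First-step decomposition of the exit expectation from a point inside the domain. -/
lemma exitLExp_of_mem (κ : Z2 → Z2 → ℝ≥0∞) {A : Set Z2} {z : Z2} (hz : z ∈ A) (g : Z2 → ℝ) :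
    exitLExp κ A z g = ∑' w, κ z w * exitLExp κ A w g := by
  unfold exitLExp
  rw [tsum_eq_zero_add' ENNReal.summable]
  simp only [tsum_exitP_zero_mul, tsum_exitP_succ_mul, hz, if_true, zero_add]
  rw [ENNReal.tsum_comm]
  exact tsum_congr fun w => ENNReal.tsum_mul_left

lemma exitLExp_of_notMem (κ : Z2 → Z2 → ℝ≥0∞) {A : Set Z2} {z : Z2} (hz : z ∉ A) (g : Z2 → ℝ) :
    exitLExp κ A z g = ENNReal.ofReal (g z) := by
  unfold exitLExp
  rw [tsum_eq_zero_add' ENNReal.summable]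
  simp [tsum_exitP_zero_mul, tsum_exitP_succ_mul, hz]

/-- A nonnegative function that is superharmonic in the domain and dominates `g` outside of it
dominates the exit expectation of `g`. -/
lemma exitLExp_le_of_superharmonic (κ : Z2 → Z2 → ℝ≥0∞) (A : Set Z2) (g : Z2 → ℝ)
    (H : Z2 → ℝ≥0∞) (hout : ∀ z ∉ A, ENNReal.ofReal (g z) ≤ H z)
    (hin : ∀ z ∈ A, ∑' w, κ z w * H w ≤ H z) (z : Z2) :
    exitLExp κ A z g ≤ H z := by
  unfold exitLExp
  rw [ENNReal.tsum_eq_iSup_nat]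
  refine iSup_le fun n => ?_
  induction n generalizing z with
  | zero => simp
  | succ n ih =>
    rw [Finset.sum_range_succ']
    simp only [tsum_exitP_zero_mul, tsum_exitP_succ_mul]
    by_cases hz : z ∈ A
    · simp only [hz, if_true, add_zero]
      rw [← Summable.tsum_finsetSum (fun _ _ => ENNReal.summable)]
      refine le_trans (ENNReal.tsum_le_tsum fun w => ?_) (hin z hz)
      rw [← Finset.mul_sum]
      gcongr
      exact ih w
    · simpa [hz] using hout z hz

/-- If `g` is nonnegative and harmonic in the domain, then the exit expectation of `g⁺` is at most
the initial value of `g` plus the exit expectation of `g⁻`. -/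
lemma exitLExp_le_add_exitLExp_neg (κ : Z2 → Z2 → ℝ≥0∞) (A : Set Z2) (g : Z2 → ℝ)
    (hpos : ∀ z ∈ A, 0 ≤ g z)
    (hfin : ∀ z ∈ A, ∑' w, κ z w * ENNReal.ofReal (-g w) ≠ ⊤)
    (hharm : ∀ z ∈ A, ∑' w, κ z w * ENNReal.ofReal (g w) =
      ENNReal.ofReal (g z) + ∑' w, κ z w * ENNReal.ofReal (-g w))
    {z : Z2} (hz : z ∈ A) :
    exitLExp κ A z g ≤ ENNReal.ofReal (g z) + exitLExp κ A z (fun w => -g w) := by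
  have key := exitLExp_le_of_superharmonic κ A g
    (fun w => ENNReal.ofReal (g w) + if w ∈ A then exitLExp κ A w (fun w => -g w) else 0)
    (fun z hz => by simp [hz]) (fun z hz => ?_) z
  · simpa [hz] using key
  · rw [← ENNReal.add_le_add_iff_right (hfin z hz), ← ENNReal.tsum_add]
    have hsplit : ∀ w, κ z w * (ENNReal.ofReal (g w) +
          if w ∈ A then exitLExp κ A w (fun w => -g w) else 0) + κ z w * ENNReal.ofReal (-g w) =
        κ z w * ENNReal.ofReal (g w) + κ z w * exitLExp κ A w (fun w => -g w) := by
      intro w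
      by_cases hw : w ∈ A
      · have : ENNReal.ofReal (-g w) = 0 :=
          ENNReal.ofReal_of_nonpos (neg_nonpos.2 (hpos w hw))
        simp [hw, this, mul_add]
      · simp [hw, exitLExp_of_notMem κ hw]
    simp only [hsplit, hz, if_true]
    rw [ENNReal.tsum_add, hharm z hz, ← exitLExp_of_mem κ hz]
    exact (add_right_comm _ _ _).le

lemma tsum_ofReal_eq_add_tsum_ofReal_neg {ι : Type*} {F : ι → ℝ} {s : ℝ} (hF : HasSum F s)
    (hs : 0 ≤ s) :
    ∑' u, ENNReal.ofReal (-F u) ≠ ⊤ ∧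
      ∑' u, ENNReal.ofReal (F u) = ENNReal.ofReal s + ∑' u, ENNReal.ofReal (-F u) := by
  have habs := hF.summable.abs
  have hp : Summable fun u => max (F u) 0 :=
    habs.of_nonneg_of_le (fun u => le_max_right _ _)
      fun u => max_le (le_abs_self _) (abs_nonneg _)
  have hn : Summable fun u => max (-F u) 0 :=
    habs.of_nonneg_of_le (fun u => le_max_right _ _)
      fun u => max_le (neg_le_abs _) (abs_nonneg _)
  have e : ∀ x : ℝ, ENNReal.ofReal x = ENNReal.ofReal (max x 0) := fun x => by
    rcases le_total x 0 with h | h <;> simp [h, ENNReal.ofReal_of_nonpos]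
  have hP : ∑' u, ENNReal.ofReal (F u) = ENNReal.ofReal (∑' u, max (F u) 0) := by
    rw [ENNReal.ofReal_tsum_of_nonneg (fun u => le_max_right _ _) hp]
    exact tsum_congr fun u => e _
  have hN : ∑' u, ENNReal.ofReal (-F u) = ENNReal.ofReal (∑' u, max (-F u) 0) := by
    rw [ENNReal.ofReal_tsum_of_nonneg (fun u => le_max_right _ _) hn]
    exact tsum_congr fun u => e _
  refine ⟨hN ▸ ENNReal.ofReal_ne_top, ?_⟩
  rw [hP, hN, ← ENNReal.ofReal_add hs (tsum_nonneg fun u => le_max_right _ _)]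
  congr 1
  rw [← hF.tsum_eq, ← hF.summable.tsum_add hn]
  refine tsum_congr fun u => ?_
  rcases le_total (F u) 0 with h | h <;> simp [h]

lemma tsum_ofReal_le_of_hasSum {ι : Type*} {F B : ι → ℝ} {s t : ℝ} (hF : ∀ u, 0 ≤ F u)
    (hFB : ∀ u, F u ≤ B u) (hB : HasSum B s) (hst : s ≤ t) :
    ∑' u, ENNReal.ofReal (F u) ≤ ENNReal.ofReal t := by
  have hFs : Summable F := hB.summable.of_nonneg_of_le hF hFB
  rw [← ENNReal.ofReal_tsum_of_nonneg hF hFs]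
  exact ENNReal.ofReal_le_ofReal ((hFs.tsum_le_tsum hFB hB.summable).trans (hB.tsum_eq ▸ hst))

/-- For a one-dimensional random walk whose steps have finite exponential moments, there is a
nonnegative function that is superharmonic on the positive half-line and dominates the
overshoot `-x` on the nonpositive half-line. -/
lemma exists_overshoot_barrier {ι : Type*} (μ X : ι → ℝ) (hμ0 : ∀ u, 0 ≤ μ u)
    (hμ1 : HasSum μ 1) (hexp : ∀ s : ℝ, Summable fun u => μ u * Real.exp (s * X u)) :
    ∃ h : ℝ → ℝ, (∀ x, 0 ≤ h x) ∧ (∀ x ≤ 0, -x ≤ h x) ∧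
      ∀ x > 0, ∑' u, ENNReal.ofReal (μ u * h (x + X u)) ≤ ENNReal.ofReal (h x) := by
  by_cases hneg : ∃ u, 0 < μ u ∧ X u < 0
  swap
  · push Not at hneg
    refine ⟨fun x => max (-x) 0, fun x => le_max_right _ _, fun x _ => le_max_left _ _,
      fun x hx => ?_⟩
    have hzero : ∀ u, μ u * max (-(x + X u)) 0 = 0 := by
      intro u
      rcases (hμ0 u).eq_or_lt with h | h
      · simp [← h]
      · rw [max_eq_right (by linarith [hneg u h]), mul_zero]
    simp only [hzero, ENNReal.ofReal_zero, tsum_zero, zero_le]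
  obtain ⟨u₀, hp, hb⟩ := hneg
  set p := μ u₀ with hpdef
  set b := -X u₀ with hbdef
  have hb0 : 0 < b := by simpa [hbdef] using hb
  obtain ⟨l, hl1, hl⟩ : ∃ l : ℝ, 1 ≤ l ∧ 2 ≤ p * Real.exp (l * b) := by
    refine ⟨max 1 (2 / (p * b)), le_max_left _ _, ?_⟩
    have h1 : 2 / p ≤ max 1 (2 / (p * b)) * b := by
      calc 2 / p = 2 / (p * b) * b := by field_simp
        _ ≤ _ := by gcongr; exact le_max_right _ _
    have h2 := Real.add_one_le_exp (max 1 (2 / (p * b)) * b)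
    calc (2 : ℝ) = p * (2 / p) := by field_simp
      _ ≤ _ := by gcongr; linarith
  set C := ∑' u, μ u * Real.exp (-l * X u) with hC
  have hCsum : HasSum (fun u => μ u * Real.exp (-l * X u)) C := (hexp (-l)).hasSum
  have hC0 : 0 ≤ C := tsum_nonneg fun u => mul_nonneg (hμ0 u) (Real.exp_pos _).le
  have hp1 : p ≤ 1 := le_hasSum hμ1 u₀ fun u _ => hμ0 u
  set M := 2 * C / p with hM
  have hMp : p * M = 2 * C := by rw [hM]; field_simp
  have hMC : 2 * C ≤ M := by
    rw [hM, le_div_iff₀ hp]; nlinarith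
  have hM0 : 0 ≤ M := by linarith
  set h : ℝ → ℝ := fun x => if 0 < x then M - C * Real.exp (-l * x) else -x with hh
  have hpos : ∀ x, 0 < x → h x = M - C * Real.exp (-l * x) := fun x hx => if_pos hx
  have hnonpos : ∀ x, x ≤ 0 → h x = -x := fun x hx => if_neg hx.not_gt
  have hexp1 : ∀ x, 0 < x → Real.exp (-l * x) ≤ 1 := fun x hx =>
    Real.exp_le_one_iff.2 (by nlinarith)
  have hnonneg : ∀ x, 0 ≤ h x := by
    intro x
    rcases lt_or_ge 0 x with hx | hx
    · rw [hpos x hx]; nlinarith [hexp1 x hx]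
    · rw [hnonpos x hx]; linarith
  have hle : ∀ x t, x ≤ 0 → t ≤ x → -x ≤ Real.exp (-l * t) := by
    intro x t hx ht
    have := Real.add_one_le_exp (-l * t)
    nlinarith
  have hleM : ∀ x, 0 < x → h x ≤ M := fun x hx => by
    rw [hpos x hx]; nlinarith [Real.exp_pos (-l * x)]
  refine ⟨h, hnonneg, fun x hx => (hnonpos x hx).ge, fun x hx => ?_⟩
  have hpoint : HasSum (fun u => if u = u₀ then p else 0) p := hasSum_ite_eq u₀ p
  rcases lt_or_ge b x with hbx | hxb
  · refine tsum_ofReal_le_of_hasSum (fun u => mul_nonneg (hμ0 u) (hnonneg _)) (fun u => ?_)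
      (((hμ1.mul_right M).add (hCsum.mul_left (Real.exp (-l * x)))).sub
        (hpoint.mul_right (C * Real.exp (-l * (x - b))))) ?_
    · have e1 : Real.exp (-l * x) * (μ u * Real.exp (-l * X u)) =
          μ u * Real.exp (-l * (x + X u)) := by
        rw [mul_add, Real.exp_add]; ring
      rw [e1]
      by_cases hu : u = u₀
      · subst hu
        have e2 : x + X u = x - b := by simp [hbdef]
        rw [e2, hpos _ (sub_pos.2 hbx)]
        simp only [if_true]
        nlinarith [mul_pos hp (Real.exp_pos (-l * (x - b)))]
      · simp only [hu, if_false, zero_mul, sub_zero, ← mul_add]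
        refine mul_le_mul_of_nonneg_left ?_ (hμ0 u)
        rcases lt_or_ge 0 (x + X u) with hy | hy
        · linarith [hleM _ hy, Real.exp_pos (-l * (x + X u))]
        · rw [hnonpos _ hy]; linarith [hle _ _ hy le_rfl]
    · rw [hpos x hx]
      have e3 : Real.exp (-l * (x - b)) = Real.exp (-l * x) * Real.exp (l * b) := by
        rw [← Real.exp_add]; ring_nf
      rw [e3]
      have := mul_le_mul_of_nonneg_left hl (mul_nonneg hC0 (Real.exp_pos (-l * x)).le)
      nlinarith
  · refine tsum_ofReal_le_of_hasSum (fun u => mul_nonneg (hμ0 u) (hnonneg _)) (fun u => ?_)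
      (((hμ1.mul_right M).add hCsum).sub (hpoint.mul_right M)) ?_
    · have hstep : x + X u ≤ 0 → h (x + X u) ≤ Real.exp (-l * X u) := fun hy => by
        rw [hnonpos _ hy]; exact hle _ _ hy (by linarith)
      by_cases hu : u = u₀
      · subst hu
        simp only [if_true, ← hpdef]
        have := mul_le_mul_of_nonneg_left (hstep (by linarith)) hp.le
        linarith
      · simp only [hu, if_false, zero_mul, sub_zero, ← mul_add]
        refine mul_le_mul_of_nonneg_left ?_ (hμ0 u)
        rcases lt_or_ge 0 (x + X u) with hy | hy
        · linarith [hleM _ hy, Real.exp_pos (-l * X u)]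
        · linarith [hstep hy]
    · rw [hpos x hx]
      nlinarith [hexp1 x hx]

lemma dotR_add_emb (a : R2) (z u : Z2) :
    dotR a (emb (z + u)) = dotR a (emb z) + dotR a (emb u) := by
  simp [dotR, emb]; ring

/-- One step of the original walk, applied to an exponentially weighted function, in terms of the
exponentially tilted step distribution. -/
lemma tsum_twKer_zero_mul (γ : Z2 → ℝ) (hγ0 : ∀ z, 0 ≤ γ z) (a : R2) (k : Z2 → ℝ) (z : Z2) :
    ∑' w, twKer γ 0 z w * ENNReal.ofReal (k w * Real.exp (dotR a (emb w))) =
      ENNReal.ofReal (Real.exp (dotR a (emb z))) *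
        ∑' u, ENNReal.ofReal (γ u * Real.exp (dotR a (emb u)) * k (z + u)) := by
  rw [← (Equiv.addLeft z).tsum_eq, ← ENNReal.tsum_mul_left]
  refine tsum_congr fun u => ?_
  rw [← ENNReal.ofReal_mul (Real.exp_pos _).le, twKer, ← ENNReal.ofReal_mul]
  · congr 1
    simp only [Equiv.coe_addLeft, add_sub_cancel_left, dotR_add_emb, Real.exp_add]
    simp [dotR]
    ring
  · exact mul_nonneg (hγ0 _) (Real.exp_pos _).le

lemma abs_le_exp_add_exp_neg (t : ℝ) : |t| ≤ Real.exp t + Real.exp (-t) := by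
  have h1 := Real.add_one_le_exp t
  have h2 := Real.add_one_le_exp (-t)
  rcases abs_cases t with ⟨h, _⟩ | ⟨h, _⟩ <;> linarith [Real.exp_pos t, Real.exp_pos (-t)]

lemma summable_tilted_mul_exp {γ : Z2 → ℝ}
    (hA3 : ∀ a : R2, Summable fun z : Z2 => γ z * Real.exp (dotR a (emb z))) (a e : R2) (s : ℝ) :
    Summable fun u : Z2 =>
      γ u * Real.exp (dotR a (emb u)) * Real.exp (s * dotR e (emb u)) := by
  refine (hA3 (a + s • e)).congr fun u => ?_
  rw [mul_assoc, ← Real.exp_add]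
  congr 2
  simp [dotR]; ring

lemma summable_tilted_mul_dotR {γ : Z2 → ℝ} (hγ0 : ∀ z, 0 ≤ γ z)
    (hA3 : ∀ a : R2, Summable fun z : Z2 => γ z * Real.exp (dotR a (emb z))) (a e : R2) :
    Summable fun u : Z2 => γ u * Real.exp (dotR a (emb u)) * dotR e (emb u) := by
  refine Summable.of_norm_bounded
    ((summable_tilted_mul_exp hA3 a e 1).add (summable_tilted_mul_exp hA3 a e (-1))) fun u => ?_
  have h0 : 0 ≤ γ u * Real.exp (dotR a (emb u)) := mul_nonneg (hγ0 u) (Real.exp_pos _).le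
  rw [Real.norm_eq_abs, abs_mul, abs_of_nonneg h0, ← mul_add, one_mul, neg_one_mul]
  exact mul_le_mul_of_nonneg_left (abs_le_exp_add_exp_neg _) h0

/-- The tilted walk has mean `∇φ(a)`. -/
lemma hasSum_tilted_mul_dotR {γ : Z2 → ℝ} (hγ0 : ∀ z, 0 ≤ γ z)
    (hA3 : ∀ a : R2, Summable fun z : Z2 => γ z * Real.exp (dotR a (emb z))) (a e : R2) :
    HasSum (fun u : Z2 => γ u * Real.exp (dotR a (emb u)) * dotR e (emb u))
      (dotR e (gradJgf γ a)) := by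
  have h1 := summable_tilted_mul_dotR hγ0 hA3 a (1, 0)
  have h2 := summable_tilted_mul_dotR hγ0 hA3 a (0, 1)
  simp only [dotR, emb, one_mul, zero_mul, add_zero, zero_add] at h1 h2
  have hfun : (fun u : Z2 => γ u * Real.exp (dotR a (emb u)) * dotR e (emb u)) = fun u =>
      e.1 * (γ u * Real.exp (dotR a (emb u)) * (u.1 : ℝ)) +
        e.2 * (γ u * Real.exp (dotR a (emb u)) * (u.2 : ℝ)) := by
    funext u
    simp only [dotR, emb]
    ring
  rw [hfun]
  exact (h1.hasSum.mul_left e.1).add (h2.hasSum.mul_left e.2)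

lemma dotR_eq_zero_of_qmap_eq {γ : Z2 → ℝ} {a c e : R2} (hc : nrm c = 1)
    (hq : qmap γ a = c) (he : dotR e c = 0) : dotR e (gradJgf γ a) = 0 := by
  have h0 : (nrm (gradJgf γ a))⁻¹ ≠ 0 := by
    intro h
    rw [qmap, h, zero_smul] at hq
    simp [← hq, nrm, dotR] at hc
  have hmul : (nrm (gradJgf γ a))⁻¹ * dotR e (gradJgf γ a) = 0 := by
    rw [← he, ← hq]
    simp only [qmap, dotR, Prod.smul_fst, Prod.smul_snd, smul_eq_mul]
    ring
  exact (mul_eq_zero.1 hmul).resolve_left h0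

/-- **Lemma 7.** For `i = 1, 2`, the function
`z ↦ (fᵢ·z)e^{a(cᵢ)·z} − 𝔼_z[fᵢ·S(τ) e^{a(cᵢ)·S(τ)}; τ < ∞]`
is well-defined and nonnegative on `K`. -/
theorem harmonic_candidate_nonneg
    (γ : Z2 → ℝ) (c f : Fin 2 → R2) (K : Set R2)
    -- `γ` is a probability distribution on `ℤ²`
    (hγ0 : ∀ z : Z2, 0 ≤ γ z) (hγ1 : HasSum γ 1)
    -- `c 0, c 1` are unit vectors, `f i` is the unit vector perpendicular to `c i`
    -- pointing into the cone; the angle between `c 0` and `c 1` lies in `(0, π)`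
    (hcUnit : ∀ i, nrm (c i) = 1) (hfUnit : ∀ i, nrm (f i) = 1)
    (hperp : ∀ i, dotR (f i) (c i) = 0)
    (hinward : ∀ i j, i ≠ j → 0 < dotR (f i) (c j))
    -- `K` is the open convex cone bounded by the rays through `c 0` and `c 1`
    (hK : K = {x : R2 | ∀ i, 0 < dotR (f i) x})
    -- (A1) the walk is irreducible with nonzero mean
    (hA1 : ∀ z z' : Z2, ∃ n : ℕ, 0 < nstep (twKer γ 0) n z z')
    (hmean : (∑' z : Z2, γ z * (z.1 : ℝ), ∑' z : Z2, γ z * (z.2 : ℝ)) ≠ (0, 0))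
    -- (A2) the walk killed when leaving `K` is irreducible in `K`
    (hA2 : ∀ z z' : Z2, emb z ∈ K → emb z' ∈ K →
        ∃ n : ℕ, 0 < aliveP (twKer γ 0) (emb ⁻¹' K) n z z')
    -- (A3) the jump generating function is finite everywhere
    (hA3 : ∀ a : R2, Summable fun z : Z2 => γ z * Real.exp (dotR a (emb z)))
    -- (A4) the projections `fᵢ·S(n)` are aperiodic random walks
    (hA4 : ∀ i : Fin 2, ∀ d : ℕ,
        (∀ n : ℕ, 0 < n →
          0 < ∑' z : Z2, (if dotR (f i) (emb z) = 0 then nstep (twKer γ 0) n 0 z else 0) →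
          d ∣ n) → d = 1)
    (i : Fin 2)
    -- `a = a(cᵢ)`
    (a : R2) (haD : jgf γ a = 1) (haq : qmap γ a = c i)
    (z : Z2) (hz : emb z ∈ K) :
    -- well-definedness: the expectation converges absolutely
    exitLExp (twKer γ 0) (emb ⁻¹' K) z
        (fun z' => |dotR (f i) (emb z')| * Real.exp (dotR a (emb z'))) ≠ ⊤ ∧
    -- nonnegativity
    0 ≤ dotR (f i) (emb z) * Real.exp (dotR a (emb z))
        - exitExp (twKer γ 0) (emb ⁻¹' K) z
            (fun z' => dotR (f i) (emb z') * Real.exp (dotR a (emb z'))) := by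
  set κ := twKer γ 0
  set A : Set Z2 := emb ⁻¹' K
  set e := f i
  set μ : Z2 → ℝ := fun u => γ u * Real.exp (dotR a (emb u)) with hμ
  set g : Z2 → ℝ := fun w => dotR e (emb w) * Real.exp (dotR a (emb w)) with hg
  have hApos : ∀ w ∈ A, 0 < dotR e (emb w) := fun w hw => by
    have hw' : emb w ∈ K := hw
    rw [hK] at hw'
    exact hw' i
  have hμ0 : ∀ u, 0 ≤ μ u := fun u => mul_nonneg (hγ0 u) (Real.exp_pos _).le
  have hμ1 : HasSum μ 1 := haD ▸ (hA3 a).hasSum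
  have hcentered : HasSum (fun u => μ u * dotR e (emb u)) 0 := by
    have := hasSum_tilted_mul_dotR hγ0 hA3 a e
    rwa [dotR_eq_zero_of_qmap_eq (hcUnit i) haq (hperp i)] at this
  have hstep : ∀ w, HasSum (fun u => μ u * dotR e (emb (w + u))) (dotR e (emb w)) := fun w => by
    simpa [dotR_add_emb, mul_add] using (hμ1.mul_right (dotR e (emb w))).add hcentered
  have hneg : ∀ w, -g w = -dotR e (emb w) * Real.exp (dotR a (emb w)) := fun w => by
    simp only [hg]; ring
  obtain ⟨h, hh0, hhle, hhsup⟩ := exists_overshoot_barrier μ (fun u => dotR e (emb u)) hμ0 hμ1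
    (fun s => summable_tilted_mul_exp hA3 a e s)
  have hovershoot : exitLExp κ A z (fun w => -g w) ≠ ⊤ := by
    refine ne_top_of_le_ne_top ENNReal.ofReal_ne_top (exitLExp_le_of_superharmonic κ A _
      (fun w => ENNReal.ofReal (h (dotR e (emb w)) * Real.exp (dotR a (emb w))))
      (fun w _ => ?_) (fun w hw => ?_) z)
    · rw [hneg]
      refine ENNReal.ofReal_le_ofReal (mul_le_mul_of_nonneg_right ?_ (Real.exp_pos _).le)
      rcases le_total (dotR e (emb w)) 0 with hx | hx
      · exact hhle _ hx
      · linarith [hh0 (dotR e (emb w))]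
    · rw [tsum_twKer_zero_mul γ hγ0 a (fun w => h (dotR e (emb w))), mul_comm (h _),
        ENNReal.ofReal_mul (Real.exp_pos _).le]
      gcongr
      simpa only [dotR_add_emb] using hhsup _ (hApos w hw)
  have hdecomp : ∀ w ∈ A, ∑' v, κ w v * ENNReal.ofReal (-g v) ≠ ⊤ ∧
      ∑' v, κ w v * ENNReal.ofReal (g v) =
        ENNReal.ofReal (g w) + ∑' v, κ w v * ENNReal.ofReal (-g v) := by
    intro w hw
    obtain ⟨h1, h2⟩ := tsum_ofReal_eq_add_tsum_ofReal_neg (hstep w) (hApos w hw).le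
    have hP := tsum_twKer_zero_mul γ hγ0 a (fun w => dotR e (emb w)) w
    have hN := tsum_twKer_zero_mul γ hγ0 a (fun w => -dotR e (emb w)) w
    simp only [← hneg, mul_neg] at hN
    rw [hN]
    refine ⟨ENNReal.mul_ne_top ENNReal.ofReal_ne_top h1, hP.trans ?_⟩
    rw [h2, mul_add, ← ENNReal.ofReal_mul (Real.exp_pos _).le, mul_comm (Real.exp _)]
  have hle := exitLExp_le_add_exitLExp_neg κ A g
    (fun w hw => mul_nonneg (hApos w hw).le (Real.exp_pos _).le)
    (fun w hw => (hdecomp w hw).1) (fun w hw => (hdecomp w hw).2) (z := z) hz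
  have hposfin : exitLExp κ A z g ≠ ⊤ :=
    ne_top_of_le_ne_top (ENNReal.add_ne_top.2 ⟨ENNReal.ofReal_ne_top, hovershoot⟩) hle
  have hgz : 0 ≤ g z := mul_nonneg (hApos z hz).le (Real.exp_pos _).le
  constructor
  · refine ne_top_of_le_ne_top (ENNReal.add_ne_top.2 ⟨hposfin, hovershoot⟩) ?_
    simp only [exitLExp, ← ENNReal.tsum_add, ← mul_add]
    gcongr with n w
    rw [← abs_of_pos (Real.exp_pos (dotR a (emb w))), ← abs_mul]
    change ENNReal.ofReal |g w| ≤ _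
    rcases abs_cases (g w) with ⟨hw, _⟩ | ⟨hw, _⟩ <;> rw [hw]
    · exact le_self_add
    · exact le_add_self
  · have hreal := ENNReal.toReal_mono
      (ENNReal.add_ne_top.2 ⟨ENNReal.ofReal_ne_top, hovershoot⟩) hle
    rw [ENNReal.toReal_add ENNReal.ofReal_ne_top hovershoot, ENNReal.toReal_ofReal hgz] at hreal
    change 0 ≤ g z - exitExp κ A z g
    unfold exitExp
    linarith
end KilledRW
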